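/- arXiv:2203.14183 — 2 statements merged into one kernel-verified Lean document; each statement's English description precedes it below -/
import Mathlib

section
/- For every real c with 0 ≤ c ≤ 1 and every real t with 0 ≤ t ≤ 1, one has 15·√((1 − 2t²)² + c) + 4√2·t·√(1 − t²) ≤ √(233(1 + c)). (With c = 1 − 2/d, this is the bound 15√((1−2τ₁²)² + (1−2/d)) + 4√2·τ₁√(1−τ₁²) ≤ √(233(2−2/d)) used in the proof of Lemma 2, part 1.) -/
theorem stmt_16 (c t : ℝ) (hc₀ : 0 ≤ c) (hc₁ : c ≤ 1) (ht₀ : 0 ≤ t) (ht₁ : t ≤ 1) :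
    15 * Real.sqrt ((1 - 2 * t ^ 2) ^ 2 + c) + 4 * Real.sqrt 2 * t * Real.sqrt (1 - t ^ 2) ≤
      Real.sqrt (233 * (1 + c)) := by
  have ha := Real.sq_sqrt (show 0 ≤ (1 - 2 * t ^ 2) ^ 2 + c by positivity)
  have hb := Real.sq_sqrt (show (0 : ℝ) ≤ 2 by norm_num)
  have hs := Real.sq_sqrt (show 0 ≤ 1 - t ^ 2 by nlinarith)
  set a := Real.sqrt ((1 - 2 * t ^ 2) ^ 2 + c)
  set b := Real.sqrt 2
  set s := Real.sqrt (1 - t ^ 2)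
  have hsum : a ^ 2 + (2 * t * s) ^ 2 = 1 + c := by
    linear_combination ha + 4 * t ^ 2 * hs
  have cauchy_schwarz : (15 * a + 4 * b * t * s) ^ 2 + (15 * (2 * t * s) - 2 * b * a) ^ 2 =
      233 * (1 + c) := by
    linear_combination 233 * hsum + 4 * (a ^ 2 + (2 * t * s) ^ 2) * hb
  apply Real.le_sqrt_of_sq_le
  linarith [sq_nonneg (15 * (2 * t * s) - 2 * b * a)]
end

section
/- Let c be real with 0 ≤ c ≤ 1 and let τ₀, τ₁ ≥ 0 with τ₀² + τ₁² ≤ 1. Then √((τ₀² − τ₁²)² + c(τ₀² + τ₁²)²) + √(c((τ₀² + τ₁²)² + c(τ₀² − τ₁²)²)) ≤ √(1 + c)·(1 + √c). (With c = 1 − 2/d this is the bound ‖N^{2|13}‖_tr/4 ≤ √(2−2/d)(1 + √(1−2/d)) used in the proof of Lemma 2, part 2, case (ii).) -/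
theorem stmt_17 (c τ₀ τ₁ : ℝ) (hc₀ : 0 ≤ c) (hc₁ : c ≤ 1)
    (h₀ : 0 ≤ τ₀) (h₁ : 0 ≤ τ₁) (hτ : τ₀ ^ 2 + τ₁ ^ 2 ≤ 1) :
    Real.sqrt ((τ₀ ^ 2 - τ₁ ^ 2) ^ 2 + c * (τ₀ ^ 2 + τ₁ ^ 2) ^ 2) +
      Real.sqrt (c * ((τ₀ ^ 2 + τ₁ ^ 2) ^ 2 + c * (τ₀ ^ 2 - τ₁ ^ 2) ^ 2)) ≤
      Real.sqrt (1 + c) * (1 + Real.sqrt c) := by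
  have hsum : (τ₀ ^ 2 + τ₁ ^ 2) ^ 2 ≤ 1 := pow_le_one₀ (by positivity) hτ
  have hdiff : (τ₀ ^ 2 - τ₁ ^ 2) ^ 2 ≤ 1 := by
    nlinarith [mul_nonneg (sq_nonneg τ₀) (sq_nonneg τ₁)]
  have hcsum := mul_le_mul_of_nonneg_left hsum hc₀
  have hcdiff := mul_le_mul_of_nonneg_left hdiff hc₀
  rw [Real.sqrt_mul hc₀]
  calc _ ≤ Real.sqrt (1 + c) + Real.sqrt c * Real.sqrt (1 + c) := by
        gcongr ?_ + _ * ?_ <;> exact Real.sqrt_le_sqrt (by linarith)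
    _ = _ := by ring
end
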